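/- arXiv:2108.06828 — 4 statements merged into one kernel-verified Lean document; each statement's English description precedes it below -/
import Mathlib

section
/- Let (X,Y) be a bivariate random vector such that Y is not almost surely a constant. Then the Dette–Siburg–Stoimenov dependence measure ξ(X,Y) lies in the interval [0,1], and ξ(X,Y) = 0 if and only if X and Y are independent. -/
open MeasureTheory ProbabilityTheory Filter

noncomputable section

/-- The Dette–Siburg–Stoimenov dependence measure
`ξ(X,Y) = ∫ Var(E[1{Y ≥ y} | X]) dF_Y(y) / ∫ Var(1{Y ≥ y}) dF_Y(y)`. -/
def dss {Ω : Type*} [MeasurableSpace Ω] (P : Measure Ω) (X Y : Ω → ℝ) : ℝ :=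
  (∫ y, variance (P[(fun ω => if y ≤ Y ω then (1 : ℝ) else 0) |
      MeasurableSpace.comap X inferInstance]) P ∂(P.map Y)) /
  (∫ y, variance (fun ω => if y ≤ Y ω then (1 : ℝ) else 0) P ∂(P.map Y))

open Set Topology

/-- A nonempty set of reals that is bounded below is covered by a monotone sequence of closed
upper rays with endpoints in the set. -/
lemma exists_antitone_subset_iUnion_Ici {S : Set ℝ} (hne : S.Nonempty) (hbdd : BddBelow S) :
    ∃ u : ℕ → ℝ, Antitone u ∧ (∀ n, u n ∈ S) ∧ S ⊆ ⋃ n, Ici (u n) := by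
  by_cases hmem : sInf S ∈ S
  · refine ⟨fun _ => sInf S, antitone_const, fun _ => hmem, fun d hd => ?_⟩
    exact mem_iUnion.2 ⟨0, csInf_le hbdd hd⟩
  · obtain ⟨u, hu, -, hlim, huS⟩ := (isGLB_csInf hne hbdd).exists_seq_antitone_tendsto hne
    refine ⟨u, hu, huS, fun d hd => ?_⟩
    have hlt : sInf S < d := (csInf_le hbdd hd).lt_of_ne fun h => hmem (h ▸ hd)
    obtain ⟨n, hn⟩ := (hlim.eventually (gt_mem_nhds hlt)).exists
    exact mem_iUnion.2 ⟨n, hn.le⟩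

/-- Two measures that are absolutely continuous with respect to `ν` agree as soon as they agree
on the upper rays `[y, ∞)` for `ν`-almost every `y`. -/
lemma measure_ext_of_ae_Ici {ν μ₁ μ₂ : Measure ℝ} [IsFiniteMeasure μ₁]
    (h₁ : μ₁ ≪ ν) (h₂ : μ₂ ≪ ν) (h : ∀ᵐ y ∂ν, μ₁ (Ici y) = μ₂ (Ici y)) : μ₁ = μ₂ := by
  refine Measure.ext_of_Ici _ _ fun y => ?_
  set S : Set ℝ := {z | μ₁ (Ici z) = μ₂ (Ici z)} ∩ Ici y
  have hnull : ν (Ici y \ S) = 0 :=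
    measure_mono_null (fun z hz hmem => hz.2 ⟨hmem, hz.1⟩) h
  rcases S.eq_empty_or_nonempty with hS | hS
  · rw [hS, sdiff_empty] at hnull
    rw [h₁ hnull, h₂ hnull]
  obtain ⟨u, hu, huS, hcover⟩ := exists_antitone_subset_iUnion_Ici hS ⟨y, fun z hz => hz.2⟩
  have hsub : (⋃ n, Ici (u n)) ⊆ Ici y := iUnion_subset fun n => Ici_subset_Ici.2 (huS n).2
  have hmono : Monotone fun n => Ici (u n) := fun m n hmn => Ici_subset_Ici.2 (hu hmn)
  have hunion : ∀ μ : Measure ℝ, μ ≪ ν → μ (⋃ n, Ici (u n)) = μ (Ici y) := fun μ hμ =>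
    measure_eq_measure_of_null_sdiff hsub
      (hμ (measure_mono_null (sdiff_subset_sdiff_right hcover) hnull))
  rw [← hunion μ₁ h₁, ← hunion μ₂ h₂]
  refine tendsto_nhds_unique (tendsto_measure_iUnion_atTop hmono) ?_
  exact (tendsto_measure_iUnion_atTop hmono).congr fun n => ((huS n).1).symm

/-- Almost every point of a finite measure on the line carries mass in its upper ray. -/
lemma ae_measure_Ici_ne_zero (ν : Measure ℝ) [IsFiniteMeasure ν] : ∀ᵐ y ∂ν, ν (Ici y) ≠ 0 := by
  have hanti : Antitone fun y => ν (Ici y) := fun a b hab => measure_mono (Ici_subset_Ici.2 hab)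
  set S : Set ℝ := {y | ν (Ici y) = 0}
  have hS : MeasurableSet S := hanti.measurable (measurableSet_singleton 0)
  set T : Set (ℝ × ℝ) := {p | p.1 ∈ S ∧ p.1 ≤ p.2}
  have hT : MeasurableSet T :=
    (measurable_fst hS).inter (measurableSet_le measurable_fst measurable_snd)
  have hT0 : ν.prod ν T = 0 := by
    refine Measure.measure_prod_null_of_ae_null hT (.of_forall fun y => ?_)
    by_cases hy : y ∈ S
    · exact measure_mono_null (fun z hz => hz.2) hy
    · exact measure_mono_null (fun z hz => hy hz.1) measure_empty
  have hT0' : ν.prod ν (Prod.swap ⁻¹' T) = 0 := by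
    rw [← Measure.map_apply measurable_swap hT, Measure.prod_swap, hT0]
  have hSS : ν.prod ν (S ×ˢ S) = 0 := by
    refine measure_mono_null (fun p hp => ?_) (measure_union_null hT0 hT0')
    rcases le_total p.1 p.2 with h | h
    · exact Or.inl ⟨hp.1, h⟩
    · exact Or.inr ⟨hp.2, h⟩
  rw [Measure.prod_prod, mul_self_eq_zero] at hSS
  simpa [ae_iff] using hSS

/-- If almost every upper ray of a probability measure on the line has measure `0` or `1`, then
the measure is concentrated at a point. -/
lemma exists_ae_eq_of_ae_measure_Ici {ν : Measure ℝ} [IsProbabilityMeasure ν]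
    (h : ∀ᵐ y ∂ν, ν (Ici y) = 0 ∨ ν (Ici y) = 1) : ∃ c, ∀ᵐ y ∂ν, y = c := by
  have hfull : ∀ᵐ y ∂ν, ∀ᵐ z ∂ν, y ≤ z := by
    filter_upwards [h, ae_measure_Ici_ne_zero ν] with y hy hy0
    exact (mem_ae_iff_prob_eq_one measurableSet_Ici).2 (hy.resolve_left hy0)
  have hmeas : MeasurableSet {p : ℝ × ℝ | p.1 ≤ p.2} :=
    measurableSet_le measurable_fst measurable_snd
  have hfull' : ∀ᵐ y ∂ν, ∀ᵐ z ∂ν, z ≤ y := (Measure.ae_ae_comm hmeas).1 hfull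
  obtain ⟨c, hc, hc'⟩ := (hfull.and hfull').exists
  exact ⟨c, by filter_upwards [hc, hc'] with z h₁ h₂ using le_antisymm h₂ h₁⟩

section

variable {Ω : Type*} {m : MeasurableSpace Ω} [m₀ : MeasurableSpace Ω] {P : Measure Ω}
  [IsProbabilityMeasure P]

lemma memLp_ite_le {Y : Ω → ℝ} (hY : Measurable Y) (y : ℝ) :
    MemLp (fun ω => if y ≤ Y ω then (1 : ℝ) else 0) 2 P := by
  refine MemLp.of_bound (C := 1) ?_ (.of_forall fun ω => ?_)
  · exact (Measurable.ite (measurableSet_le measurable_const hY)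
      measurable_const measurable_const).aestronglyMeasurable
  · split_ifs <;> simp

lemma integral_ite_le {Y : Ω → ℝ} (hY : Measurable Y) (μ : Measure Ω) (y : ℝ) :
    ∫ ω, (if y ≤ Y ω then (1 : ℝ) else 0) ∂μ = μ.real (Y ⁻¹' Ici y) := by
  rw [← integral_indicator_one (hY measurableSet_Ici)]
  rfl

lemma variance_condExp_le (hm : m ≤ m₀) {f : Ω → ℝ} (hf : MemLp f 2 P) :
    Var[P[f | m]; P] ≤ Var[f; P] := by
  rw [← integral_condVar_add_variance_condExp hm hf]
  refine le_add_of_nonneg_left (integral_nonneg_of_ae ?_)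
  exact condExp_nonneg (.of_forall fun ω => sq_nonneg _)

lemma variance_ite_le {Y : Ω → ℝ} (hY : Measurable Y) (y : ℝ) :
    Var[fun ω => if y ≤ Y ω then (1 : ℝ) else 0; P]
      = P.real (Y ⁻¹' Ici y) * (1 - P.real (Y ⁻¹' Ici y)) := by
  have hsq : (fun ω => if y ≤ Y ω then (1 : ℝ) else 0) ^ 2
      = fun ω => if y ≤ Y ω then (1 : ℝ) else 0 := by
    ext ω
    simp
  rw [variance_eq_sub (memLp_ite_le hY y), hsq, integral_ite_le hY P y]
  ring

lemma variance_ite_le_le_one {Y : Ω → ℝ} (hY : Measurable Y) (y : ℝ) :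
    Var[fun ω => if y ≤ Y ω then (1 : ℝ) else 0; P] ≤ 1 := by
  rw [variance_ite_le hY]
  nlinarith [measureReal_nonneg (μ := P) (s := Y ⁻¹' Ici y),
    measureReal_le_one (μ := P) (s := Y ⁻¹' Ici y)]

lemma measurable_measureReal_preimage_Ici (Y : Ω → ℝ) :
    Measurable fun y => P.real (Y ⁻¹' Ici y) :=
  Antitone.measurable fun _ _ hab => measureReal_mono (preimage_mono (Ici_subset_Ici.2 hab))

lemma integrable_variance_ite_le {Y : Ω → ℝ} (hY : Measurable Y) :
    Integrable (fun y => Var[fun ω => if y ≤ Y ω then (1 : ℝ) else 0; P]) (P.map Y) := by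
  have := Measure.isProbabilityMeasure_map (μ := P) hY.aemeasurable
  refine Integrable.of_bound (C := 1) ?_ (.of_forall fun y => ?_)
  · simp_rw [variance_ite_le hY]
    have := measurable_measureReal_preimage_Ici (P := P) Y
    exact (this.mul (measurable_const.sub this)).aestronglyMeasurable
  · rw [Real.norm_of_nonneg (variance_nonneg _ _)]
    exact variance_ite_le_le_one hY y

/-- The second moment of `E[1{Y ≥ y} | m]` is antitone in `y`, which gives measurability of the
variance. -/
lemma integrable_variance_condExp_ite_le (hm : m ≤ m₀) {Y : Ω → ℝ}
    (hY : Measurable Y) :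
    Integrable (fun y => Var[P[fun ω => if y ≤ Y ω then (1 : ℝ) else 0 | m]; P]) (P.map Y) := by
  refine (integrable_variance_ite_le hY).mono' ?_ (.of_forall fun y => ?_)
  · have hanti : Antitone fun y =>
        ∫ ω, (P[fun ω => if y ≤ Y ω then (1 : ℝ) else 0 | m] ^ 2) ω ∂P := by
      intro a b hab
      refine integral_mono_ae ((memLp_ite_le hY b).condExp one_le_two).integrable_sq
        ((memLp_ite_le hY a).condExp one_le_two).integrable_sq ?_
      have hle : P[fun ω => if b ≤ Y ω then (1 : ℝ) else 0 | m]
          ≤ᵐ[P] P[fun ω => if a ≤ Y ω then (1 : ℝ) else 0 | m] := by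
        refine condExp_mono ((memLp_ite_le hY b).integrable one_le_two)
          ((memLp_ite_le hY a).integrable one_le_two) (.of_forall fun ω => ?_)
        dsimp only
        split_ifs with h₁ h₂ <;> first | exact absurd (hab.trans h₁) h₂ | norm_num
      have hnonneg : 0 ≤ᵐ[P] P[fun ω => if b ≤ Y ω then (1 : ℝ) else 0 | m] :=
        condExp_nonneg (.of_forall fun ω => by dsimp only; split_ifs <;> simp)
      filter_upwards [hle, hnonneg] with ω h₁ h₂
      exact pow_le_pow_left₀ h₂ h₁ 2
    simp_rw [variance_eq_sub ((memLp_ite_le hY _).condExp one_le_two), integral_condExp hm,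
      integral_ite_le hY P]
    exact (hanti.measurable.sub
      ((measurable_measureReal_preimage_Ici Y).pow_const 2)).aestronglyMeasurable
  · rw [Real.norm_of_nonneg (variance_nonneg _ _)]
    exact variance_condExp_le hm (memLp_ite_le hY y)

lemma integral_variance_ite_le_pos {Y : Ω → ℝ} (hY : Measurable Y)
    (hconst : ¬ ∃ c : ℝ, ∀ᵐ ω ∂P, Y ω = c) :
    0 < ∫ y, Var[fun ω => if y ≤ Y ω then (1 : ℝ) else 0; P] ∂(P.map Y) := by
  have := Measure.isProbabilityMeasure_map (μ := P) hY.aemeasurable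
  refine (integral_nonneg fun y => variance_nonneg _ _).lt_of_ne fun h => hconst ?_
  have hzero := (integral_eq_zero_iff_of_nonneg (fun y => variance_nonneg _ _)
    (integrable_variance_ite_le hY)).1 h.symm
  have hray : ∀ᵐ y ∂(P.map Y), P.map Y (Ici y) = 0 ∨ P.map Y (Ici y) = 1 := by
    filter_upwards [hzero] with y hy
    rw [Measure.map_apply hY measurableSet_Ici]
    rw [variance_ite_le hY, Pi.zero_apply, mul_eq_zero, sub_eq_zero] at hy
    refine hy.imp (fun h => (measureReal_eq_zero_iff).1 h) fun h => ?_
    rw [← ofReal_measureReal, ← h, ENNReal.ofReal_one]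
  obtain ⟨c, hc⟩ := exists_ae_eq_of_ae_measure_Ici hray
  exact ⟨c, ae_of_ae_map hY.aemeasurable hc⟩

/-- If `E[1{Y ≥ y} | X]` has zero variance for almost every `y`, then `X` and `Y` are
independent. -/
lemma indepFun_of_ae_variance_condExp_eq_zero {X Y : Ω → ℝ} (hX : Measurable X)
    (hY : Measurable Y)
    (h : ∀ᵐ y ∂(P.map Y), Var[P[fun ω => if y ≤ Y ω then (1 : ℝ) else 0 |
      MeasurableSpace.comap X inferInstance]; P] = 0) :
    IndepFun X Y P := by
  rw [indepFun_iff_measure_inter_preimage_eq_mul]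
  intro s t hs ht
  have hA : MeasurableSet (X ⁻¹' s) := hX hs
  have hext : (P.restrict (X ⁻¹' s)).map Y = P (X ⁻¹' s) • P.map Y := by
    refine measure_ext_of_ae_Ici (ν := P.map Y)
      (Measure.absolutelyContinuous_of_le (Measure.map_mono Measure.restrict_le_self hY))
      Measure.smul_absolutelyContinuous ?_
    filter_upwards [h] with y hy
    have hf := memLp_ite_le (P := P) hY y
    have hce := ae_eq_integral_of_variance_eq_zero (hf.condExp one_le_two) hy
    rw [integral_condExp hX.comap_le, integral_ite_le hY] at hce
    have hint := setIntegral_condExp hX.comap_le (hf.integrable one_le_two)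
      (s := X ⁻¹' s) ⟨s, hs, rfl⟩
    rw [integral_congr_ae (ae_restrict_of_ae hce), integral_ite_le hY, setIntegral_const,
      smul_eq_mul] at hint
    rw [Measure.smul_apply, smul_eq_mul, Measure.map_apply hY measurableSet_Ici,
      Measure.map_apply hY measurableSet_Ici,
      ← ENNReal.toReal_eq_toReal_iff' (measure_ne_top _ _)
        (ENNReal.mul_ne_top (measure_ne_top _ _) (measure_ne_top _ _)), ENNReal.toReal_mul]
    exact hint.symm
  have := congrArg (fun μ => μ t) hext
  simpa [Measure.map_apply hY ht, Measure.restrict_apply (hY ht), inter_comm] using this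

lemma variance_condExp_eq_zero_of_indepFun {X Y : Ω → ℝ} (hX : Measurable X) (hY : Measurable Y)
    (h : IndepFun X Y P) (y : ℝ) :
    Var[P[fun ω => if y ≤ Y ω then (1 : ℝ) else 0 |
      MeasurableSpace.comap X inferInstance]; P] = 0 := by
  have hf : Measurable[MeasurableSpace.comap Y inferInstance]
      fun ω => if y ≤ Y ω then (1 : ℝ) else 0 :=
    (Measurable.ite measurableSet_Ici measurable_const measurable_const :
      Measurable fun z : ℝ => if y ≤ z then (1 : ℝ) else 0).comp (comap_measurable Y)
  rw [variance_congr (condExp_indep_eq hY.comap_le hX.comap_le hf.stronglyMeasurable h.symm)]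
  simp [variance_eq_integral aemeasurable_const]

end

/-- If `Y` is not almost surely a constant, then `ξ(X,Y) ∈ [0,1]`, and
`ξ(X,Y) = 0` if and only if `X` and `Y` are independent. -/
theorem dss_mem_Icc_and_eq_zero_iff_indep
    {Ω : Type*} [MeasurableSpace Ω] (P : Measure Ω) [IsProbabilityMeasure P]
    (X Y : Ω → ℝ) (hX : Measurable X) (hY : Measurable Y)
    (hconst : ¬ ∃ c : ℝ, ∀ᵐ ω ∂P, Y ω = c) :
    dss P X Y ∈ Set.Icc (0 : ℝ) 1 ∧ (dss P X Y = 0 ↔ IndepFun X Y P) := by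
  have hpos := integral_variance_ite_le_pos hY hconst
  have hint := integrable_variance_condExp_ite_le (P := P) hX.comap_le hY
  refine ⟨⟨div_nonneg (integral_nonneg fun y => variance_nonneg _ _) hpos.le, ?_⟩, ?_⟩
  · refine (div_le_one hpos).2 (integral_mono hint (integrable_variance_ite_le hY) fun y => ?_)
    exact variance_condExp_le hX.comap_le (memLp_ite_le hY y)
  · rw [dss, div_eq_zero_iff, or_iff_left hpos.ne',
      integral_eq_zero_iff_of_nonneg (fun y => variance_nonneg _ _) hint]
    exact ⟨indepFun_of_ae_variance_condExp_eq_zero hX hY,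
      fun h => .of_forall (variance_condExp_eq_zero_of_indepFun hX hY h)⟩
end
end

section
/- For any sample of size n ≥ 2 with no ties, Chatterjee's rank correlation ξ_n = 1 - 3·Σ_{i=1}^n |R_{j_1(i)} - R_i| / (n²-1) and the revised statistic with M = 1 satisfy the deterministic inequality |((n+1/2)/(n-1))·ξ_{n,1} - ξ_n| ≤ 3/(n+1); consequently |ξ_{n,1} - ξ_n| = O(1/n). -/
open Finset

noncomputable section

/-- The rank of `Y_i` among `Y_1,…,Y_n`. -/
def rankOf {n : ℕ} (y : Fin n → ℝ) (i : Fin n) : ℕ :=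
  (Finset.univ.filter fun j => y j ≤ y i).card

/-- The index of the `m`-th right nearest neighbor of `X_i` (the index `j` such that exactly
`m` sample points `X_k` satisfy `X_i < X_k ≤ X_j`); equals `i` if no such index exists. -/
def rightNN {n : ℕ} (x : Fin n → ℝ) (m : ℕ) (i : Fin n) : Fin n :=
  if h : ∃ j, (Finset.univ.filter fun k => x i < x k ∧ x k ≤ x j).card = m then h.choose else i

/-- The revised Chatterjee rank correlation `ξ_{n,M}`. -/
def xiStat (n M : ℕ) (x y : Fin n → ℝ) : ℝ :=
  -2 + 6 * (∑ i, ∑ m ∈ Finset.Icc 1 M,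
      (min (rankOf y i) (rankOf y (rightNN x m i)) : ℝ)) /
    ((n + 1) * (n * M + M * (M + 1) / 4))

/-- Chatterjee's original rank correlation `ξ_n = 1 - 3 Σᵢ |R_{j₁(i)} - R_i| / (n² - 1)`. -/
def chatterjeeXi (n : ℕ) (x y : Fin n → ℝ) : ℝ :=
  1 - 3 * (∑ i, |((rankOf y (rightNN x 1 i) : ℝ) - (rankOf y i : ℝ))|) / ((n : ℝ) ^ 2 - 1)

theorem one_le_rankOf {n : ℕ} (y : Fin n → ℝ) (i : Fin n) : 1 ≤ rankOf y i :=
  Finset.card_pos.mpr ⟨i, by simp⟩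

theorem rankOf_le {n : ℕ} (y : Fin n → ℝ) (i : Fin n) : rankOf y i ≤ n :=
  (Finset.card_le_univ _).trans_eq (Fintype.card_fin n)

/-- Without ties the ranks sum to `n (n + 1) / 2`. -/
theorem two_mul_sum_rankOf {n : ℕ} {y : Fin n → ℝ} (hy : Function.Injective y) :
    2 * ∑ i, (rankOf y i : ℝ) = n * (n + 1) := by
  have h : ∀ i, (rankOf y i : ℝ) = ∑ j, if y j ≤ y i then (1 : ℝ) else 0 := fun i => by
    simp [rankOf]
  have hpair : ∀ i j : Fin n, ((if y j ≤ y i then (1 : ℝ) else 0) +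
      if y i ≤ y j then (1 : ℝ) else 0) = 1 + if i = j then 1 else 0 := by
    intro i j
    rcases eq_or_ne i j with rfl | hij
    · simp
    · rcases lt_or_gt_of_ne (hy.ne hij) with hlt | hlt
      · simp [hlt.le, hlt.not_ge, hij]
      · simp [hlt.le, hlt.not_ge, hij]
  calc 2 * ∑ i, (rankOf y i : ℝ)
      = ∑ i, ∑ j, ((if y j ≤ y i then (1 : ℝ) else 0) + if y i ≤ y j then (1 : ℝ) else 0) := by
        simp_rw [Finset.sum_add_distrib, h]
        rw [Finset.sum_comm (f := fun i j => if y i ≤ y j then (1 : ℝ) else 0)]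
        ring
    _ = n * (n + 1) := by
        simp_rw [hpair, Finset.sum_add_distrib]
        simp
        ring

theorem rightNN_one_spec {n : ℕ} {x : Fin n → ℝ} (hx : Function.Injective x) {i l : Fin n}
    (hil : x i < x l) :
    x i < x (rightNN x 1 i) ∧
      ∀ k, x i < x k → x k ≤ x (rightNN x 1 i) → k = rightNN x 1 i := by
  have hex : ∃ j, (Finset.univ.filter fun k => x i < x k ∧ x k ≤ x j).card = 1 := by
    obtain ⟨j, hj, hmin⟩ := (Finset.univ.filter fun k => x i < x k).exists_min_image x
      ⟨l, by simpa using hil⟩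
    simp only [Finset.mem_filter, Finset.mem_univ, true_and] at hj hmin
    refine ⟨j, Finset.card_eq_one.mpr ⟨j, ?_⟩⟩
    ext k
    simp only [Finset.mem_filter, Finset.mem_univ, true_and, Finset.mem_singleton]
    constructor
    · exact fun hk => hx (hk.2.antisymm (hmin k hk.1))
    · rintro rfl
      exact ⟨hj, le_rfl⟩
  have hc : (Finset.univ.filter fun k => x i < x k ∧ x k ≤ x (rightNN x 1 i)).card = 1 := by
    rw [rightNN, dif_pos hex]
    exact hex.choose_spec
  obtain ⟨a, ha⟩ := Finset.card_eq_one.mp hc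
  have hmem : ∀ k, (x i < x k ∧ x k ≤ x (rightNN x 1 i)) ↔ k = a := fun k => by
    simpa using Finset.ext_iff.mp ha k
  have ha' := (hmem a).mpr rfl
  have hlt := ha'.1.trans_le ha'.2
  exact ⟨hlt, fun k h1 h2 => ((hmem k).mp ⟨h1, h2⟩).trans ((hmem _).mp ⟨hlt, le_rfl⟩).symm⟩

theorem rightNN_one_of_forall_le {n : ℕ} {x : Fin n → ℝ} {i : Fin n} (hi : ∀ k, x k ≤ x i) :
    rightNN x 1 i = i := by
  refine dif_neg ?_
  rintro ⟨j, hj⟩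
  obtain ⟨k, hk⟩ := Finset.card_pos.mp (hj ▸ Nat.one_pos)
  exact (Finset.mem_filter.mp hk).2.1.not_ge (hi k)

/-- Right nearest neighbors run once through all indices, except that the leftmost point is
replaced by a second copy of the rightmost point. -/
theorem exists_sum_rightNN_one {n : ℕ} (hn : n ≠ 0) {x : Fin n → ℝ}
    (hx : Function.Injective x) (f : Fin n → ℝ) :
    ∃ a b, ∑ i, f (rightNN x 1 i) = ∑ i, f i + f b - f a := by
  have : NeZero n := ⟨hn⟩
  obtain ⟨a, -, ha⟩ := (Finset.univ : Finset (Fin n)).exists_min_image x Finset.univ_nonempty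
  obtain ⟨b, -, hb⟩ := (Finset.univ : Finset (Fin n)).exists_max_image x Finset.univ_nonempty
  simp only [Finset.mem_univ, true_implies] at ha hb
  have hlt : ∀ i, i ≠ b → x i < x b := fun i hi => lt_of_le_of_ne (hb i) (hx.ne hi)
  have hinj : Set.InjOn (rightNN x 1) (Finset.univ.erase b : Finset (Fin n)) := by
    intro i hi k hk hik
    simp only [Finset.coe_erase, Finset.coe_univ, Set.mem_sdiff, Set.mem_univ, true_and,
      Set.mem_singleton_iff] at hi hk
    obtain ⟨i1, i2⟩ := rightNN_one_spec hx (hlt i hi)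
    obtain ⟨k1, k2⟩ := rightNN_one_spec hx (hlt k hk)
    rcases lt_trichotomy (x i) (x k) with h | h | h
    · have := i2 k h (hik ▸ k1.le)
      rw [hik] at this
      exact absurd (congrArg x this) k1.ne
    · exact hx h
    · have := k2 i h (hik ▸ i1.le)
      rw [← hik] at this
      exact absurd (congrArg x this) i1.ne
  have himage : (Finset.univ.erase b).image (rightNN x 1) = Finset.univ.erase a := by
    refine Finset.eq_of_subset_of_card_le ?_ ?_
    · intro j hj
      obtain ⟨i, hi, rfl⟩ := Finset.mem_image.mp hj
      have h1 := (rightNN_one_spec hx (hlt i (Finset.ne_of_mem_erase hi))).1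
      exact Finset.mem_erase.mpr
        ⟨fun h => (ha i).not_gt (h ▸ h1), Finset.mem_univ _⟩
    · rw [Finset.card_image_of_injOn hinj]
      simp
  refine ⟨a, b, ?_⟩
  have h1 := Finset.add_sum_erase Finset.univ (fun i => f (rightNN x 1 i)) (Finset.mem_univ b)
  have h2 := Finset.add_sum_erase Finset.univ f (Finset.mem_univ a)
  rw [← himage, Finset.sum_image hinj] at h2
  simp only [rightNN_one_of_forall_le hb] at h1
  linarith

theorem abs_scaled_xiStat_one_sub_chatterjeeXi_le {n : ℕ} (hn : 2 ≤ n) {x y : Fin n → ℝ}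
    (hx : Function.Injective x) (hy : Function.Injective y) :
    |(((n : ℝ) + 1 / 2) / ((n : ℝ) - 1)) * xiStat n 1 x y - chatterjeeXi n x y|
      ≤ 3 / ((n : ℝ) + 1) := by
  have hn' : (2 : ℝ) ≤ n := by exact_mod_cast hn
  obtain ⟨a, b, hab⟩ := exists_sum_rightNN_one (by omega) hx fun i => (rankOf y i : ℝ)
  have hsum := two_mul_sum_rankOf hy
  have hmin : ∑ i, min (rankOf y i : ℝ) (rankOf y (rightNN x 1 i)) =
      (n * (n + 1) + ((rankOf y b : ℝ) - rankOf y a) -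
        ∑ i, |(rankOf y (rightNN x 1 i) : ℝ) - rankOf y i|) / 2 := by
    have hpoint : ∀ u v : ℝ, min u v = (u + v - |v - u|) / 2 := fun u v => by
      rcases le_total u v with h | h
      · rw [min_eq_left h, abs_of_nonneg (sub_nonneg.mpr h)]
        ring
      · rw [min_eq_right h, abs_of_nonpos (sub_nonpos.mpr h)]
        ring
    simp_rw [hpoint]
    rw [← hsum, ← Finset.sum_div, Finset.sum_sub_distrib, Finset.sum_add_distrib, hab]
    ring
  have hdiff : (((n : ℝ) + 1 / 2) / ((n : ℝ) - 1)) * xiStat n 1 x y - chatterjeeXi n x y =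
      3 * ((rankOf y b : ℝ) - rankOf y a) / ((n - 1) * (n + 1)) := by
    simp only [xiStat, chatterjeeXi, Finset.Icc_self, Finset.sum_singleton, hmin, Nat.cast_one]
    have e1 : (n : ℝ) - 1 ≠ 0 := by linarith
    have e2 : (n : ℝ) + 1 ≠ 0 := by linarith
    have e3 : (n : ℝ) * 1 + 1 * (1 + 1) / 4 = n + 1 / 2 := by ring
    have e4 : (n : ℝ) + 1 / 2 ≠ 0 := by linarith
    have e5 : (n : ℝ) ^ 2 - 1 = (n - 1) * (n + 1) := by ring
    rw [e3, e5]
    generalize (∑ i, |(rankOf y (rightNN x 1 i) : ℝ) - rankOf y i|) = D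
    field_simp
    ring
  have hbound : ∀ i, (1 : ℝ) ≤ rankOf y i ∧ (rankOf y i : ℝ) ≤ n := fun i =>
    ⟨by exact_mod_cast one_le_rankOf y i, by exact_mod_cast rankOf_le y i⟩
  have hδ : |(rankOf y b : ℝ) - rankOf y a| ≤ n - 1 := by
    rw [abs_le]
    constructor <;> linarith [hbound a, hbound b]
  have hpos : (0 : ℝ) < (n - 1) * (n + 1) := by nlinarith
  rw [hdiff, abs_div, abs_mul, abs_of_pos hpos, abs_of_pos (three_pos : (0 : ℝ) < 3),
    div_le_div_iff₀ hpos (by linarith)]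
  nlinarith

theorem abs_xiStat_one_le {n : ℕ} (x y : Fin n → ℝ) : |xiStat n 1 x y| ≤ 4 := by
  have h0 : 0 ≤ ∑ i, min (rankOf y i : ℝ) (rankOf y (rightNN x 1 i)) :=
    Finset.sum_nonneg fun i _ => by positivity
  have h1 : ∑ i, min (rankOf y i : ℝ) (rankOf y (rightNN x 1 i)) ≤ n * n := by
    calc _ ≤ ∑ _i : Fin n, (n : ℝ) := Finset.sum_le_sum fun i _ =>
          (min_le_left _ _).trans (by exact_mod_cast rankOf_le y i)
      _ = n * n := by simp
  simp only [xiStat, Finset.Icc_self, Finset.sum_singleton, Nat.cast_one]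
  set S := ∑ i, min (rankOf y i : ℝ) (rankOf y (rightNN x 1 i))
  have hn : (0 : ℝ) ≤ n := n.cast_nonneg
  have hpos : (0 : ℝ) < (n + 1) * (n * 1 + 1 * (1 + 1) / 4) := by positivity
  have hlo : 0 ≤ 6 * S / ((n + 1) * (n * 1 + 1 * (1 + 1) / 4)) := by positivity
  have hhi : 6 * S / ((n + 1) * (n * 1 + 1 * (1 + 1) / 4)) ≤ 6 := by
    rw [div_le_iff₀ hpos]
    nlinarith
  rw [abs_le]
  constructor <;> linarith

/-- For any sample of size `n ≥ 2` with no ties,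
`|((n+1/2)/(n-1))·ξ_{n,1} - ξ_n| ≤ 3/(n+1)`; consequently `|ξ_{n,1} - ξ_n| = O(1/n)`. -/
theorem xiStat_one_close_to_chatterjeeXi :
    (∀ n : ℕ, 2 ≤ n → ∀ x y : Fin n → ℝ, Function.Injective x → Function.Injective y →
      |(((n : ℝ) + 1 / 2) / ((n : ℝ) - 1)) * xiStat n 1 x y - chatterjeeXi n x y|
        ≤ 3 / ((n : ℝ) + 1)) ∧
    (∃ C > (0 : ℝ), ∀ n : ℕ, 2 ≤ n → ∀ x y : Fin n → ℝ,
      Function.Injective x → Function.Injective y →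
      |xiStat n 1 x y - chatterjeeXi n x y| ≤ C / n) := by
  refine ⟨fun n hn x y hx hy => abs_scaled_xiStat_one_sub_chatterjeeXi_le hn hx hy,
    15, by norm_num, fun n hn x y hx hy => ?_⟩
  have hn' : (2 : ℝ) ≤ n := by exact_mod_cast hn
  have hscaled := abs_scaled_xiStat_one_sub_chatterjeeXi_le hn hx hy
  have hsplit : xiStat n 1 x y - chatterjeeXi n x y =
      ((((n : ℝ) + 1 / 2) / ((n : ℝ) - 1)) * xiStat n 1 x y - chatterjeeXi n x y) -
        (3 / 2 / ((n : ℝ) - 1)) * xiStat n 1 x y := by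
    have : (n : ℝ) - 1 ≠ 0 := by linarith
    field_simp
    ring
  have hcoef : 3 / 2 / ((n : ℝ) - 1) ≤ 3 / n := by
    rw [div_le_div_iff₀ (by linarith) (by linarith)]
    linarith
  have hcoef0 : 0 ≤ 3 / 2 / ((n : ℝ) - 1) := div_nonneg (by norm_num) (by linarith)
  have hrest : |(3 / 2 / ((n : ℝ) - 1)) * xiStat n 1 x y| ≤ 3 / n * 4 := by
    rw [abs_mul, abs_of_nonneg hcoef0]
    exact mul_le_mul hcoef (abs_xiStat_one_le x y) (abs_nonneg _) (by positivity)
  have hfirst : 3 / ((n : ℝ) + 1) ≤ 3 / n :=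
    div_le_div_of_nonneg_left (by norm_num) (by linarith) (by linarith)
  calc |xiStat n 1 x y - chatterjeeXi n x y|
      ≤ 3 / n + 3 / n * 4 := by
        rw [hsplit]
        exact (abs_sub _ _).trans (add_le_add (hscaled.trans hfirst) hrest)
    _ = 15 / n := by ring
end
end

section
/- Suppose the data satisfy Y_i = f(X_i) for a strictly increasing function f, with the X_i pairwise distinct. Then for any M ∈ [n] the revised Chatterjee rank correlation equals exactly ξ_{n,M} = 1 - (3(M+1)/4) / (n + (M+1)/4). -/
open Finset

noncomputable section

theorem rankOf_mono {n : ℕ} {y : Fin n → ℝ} {i j : Fin n} (h : y i ≤ y j) :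
    rankOf y i ≤ rankOf y j :=
  Finset.card_le_card fun k hk => by
    simp only [Finset.mem_filter, Finset.mem_univ, true_and] at hk ⊢
    exact hk.trans h

theorem le_rightNN {n : ℕ} (x : Fin n → ℝ) {m : ℕ} (hm : 1 ≤ m) (i : Fin n) :
    x i ≤ x (rightNN x m i) := by
  unfold rightNN
  split_ifs with h
  · obtain ⟨k, hk⟩ := Finset.card_pos.1 (hm.trans_eq h.choose_spec.symm)
    simp only [Finset.mem_filter, Finset.mem_univ, true_and] at hk
    exact hk.1.le.trans hk.2
  · exact le_rfl

/-- If `Y_i = f(X_i)` for a strictly increasing `f` and the `X_i` are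
pairwise distinct, then for any `M ∈ [n]`,
`ξ_{n,M} = 1 - (3(M+1)/4)/(n + (M+1)/4)` exactly. -/
theorem xiStat_of_strictMono (n M : ℕ) (hn : 1 ≤ n) (hM1 : 1 ≤ M) (hMn : M ≤ n)
    (x : Fin n → ℝ) (hx : Function.Injective x)
    (f : ℝ → ℝ) (hf : StrictMono f) :
    xiStat n M x (fun i => f (x i))
      = 1 - (3 * (M + 1) / 4) / ((n : ℝ) + (M + 1) / 4) := by
  have hsum : (∑ i, ∑ m ∈ Finset.Icc 1 M,
      (min (rankOf (fun i => f (x i)) i)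
        (rankOf (fun i => f (x i)) (rightNN x m i)) : ℝ)) = M * (n * (n + 1) / 2) := by
    have hinner : ∀ i, (∑ m ∈ Finset.Icc 1 M,
        (min (rankOf (fun i => f (x i)) i)
          (rankOf (fun i => f (x i)) (rightNN x m i)) : ℝ))
        = M * (rankOf (fun i => f (x i)) i : ℝ) := fun i => by
      rw [Finset.sum_congr rfl fun m hm => min_eq_left (Nat.cast_le.2 (rankOf_mono
        (hf.monotone (le_rightNN x (Finset.mem_Icc.1 hm).1 i))))]
      simp
    rw [Finset.sum_congr rfl fun i _ => hinner i, ← Finset.mul_sum,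
      ← two_mul_sum_rankOf (y := fun i => f (x i)) (hf.injective.comp hx)]
    ring
  have hM : (0 : ℝ) < M := Nat.cast_pos.2 hM1
  have hden : (n : ℝ) * M + M * (M + 1) / 4 = M * (n + (M + 1) / 4) := by ring
  have hpos : (0 : ℝ) < n + (M + 1) / 4 := by positivity
  rw [xiStat, hsum, hden]
  field_simp
  ring
end
end

section
/- Let [R_1,...,R_n] be a uniformly random permutation of [n] (with n ≥ 4). Then the following exact identities hold: E[R_1] = (n+1)/2; E[min{R_1,R_2}] = (n+1)/3; Var[R_1] = (n+1)(n-1)/12; Cov[R_1,R_2] = -(n+1)/12; Cov[R_1, min{R_2,R_3}] = -(n+1)/12; Cov[R_1, min{R_1,R_2}] = (n-2)(n+1)/24; Cov[min{R_1,R_2}, min{R_3,R_4}] = -4(n+1)/45; Cov[min{R_1,R_2}, min{R_1,R_3}] = (n+1)(4n-17)/180; Var[min{R_1,R_2}] = (n-2)(n+1)/18. -/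
open MeasureTheory ProbabilityTheory Filter

noncomputable section

instance permMeasurableSpace (n : ℕ) : MeasurableSpace (Equiv.Perm (Fin n)) := ⊤

/-- Covariance of two real random variables. -/
def cov {Ω : Type*} [MeasurableSpace Ω] (P : Measure Ω) (f g : Ω → ℝ) : ℝ :=
  ∫ ω, (f ω - ∫ ω', f ω' ∂P) * (g ω - ∫ ω', g ω' ∂P) ∂P

/-- The rank `R_i = σ(i) + 1 ∈ [n]` associated with a random permutation `σ`. -/
def rankRV {Ω : Type*} {n : ℕ} (σ : Ω → Equiv.Perm (Fin n)) (i : Fin n) (ω : Ω) : ℝ :=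
  ((σ ω i : ℕ) : ℝ) + 1

open Finset in
theorem sum_range_succ_cast (n : ℕ) :
    ∑ b ∈ range n, ((b : ℝ) + 1) = (n : ℝ) * (n + 1) / 2 := by
  induction n with
  | zero => simp
  | succ n ih => rw [sum_range_succ, ih]; push_cast; ring

open Finset in
theorem sum_range_succ_cast_sq (n : ℕ) :
    ∑ b ∈ range n, ((b : ℝ) + 1) ^ 2 = (n : ℝ) * (n + 1) * (2 * n + 1) / 6 := by
  induction n with
  | zero => simp
  | succ n ih => rw [sum_range_succ, ih]; push_cast; ring

open Finset in
theorem sum_range_succ_cast_cube (n : ℕ) :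
    ∑ b ∈ range n, ((b : ℝ) + 1) ^ 3 = (n : ℝ) ^ 2 * (n + 1) ^ 2 / 4 := by
  induction n with
  | zero => simp
  | succ n ih => rw [sum_range_succ, ih]; push_cast; ring

open Finset in
theorem sum_range_succ_cast_pow_four (n : ℕ) :
    ∑ b ∈ range n, ((b : ℝ) + 1) ^ 4
      = (n : ℝ) * (n + 1) * (2 * n + 1) * (3 * n ^ 2 + 3 * n - 1) / 30 := by
  induction n with
  | zero => simp
  | succ n ih => rw [sum_range_succ, ih]; push_cast; ring

open Finset in
theorem sum_range_min_succ {a n : ℕ} (h : a ≤ n) :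
    ∑ b ∈ range n, min ((a : ℝ) + 1) ((b : ℝ) + 1)
      = ((2 * n + 1) * ((a : ℝ) + 1) - ((a : ℝ) + 1) ^ 2) / 2 := by
  induction n, h using Nat.le_induction with
  | base =>
    have : ∀ b ∈ range a, min ((a : ℝ) + 1) ((b : ℝ) + 1) = (b : ℝ) + 1 := fun b hb => by
      have : (b : ℝ) ≤ a := by exact_mod_cast (mem_range.1 hb).le
      exact min_eq_right (by linarith)
    rw [sum_congr rfl this, sum_range_succ_cast]
    ring
  | succ n h ih =>
    have : (a : ℝ) ≤ n := by exact_mod_cast h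
    rw [sum_range_succ, ih, min_eq_left (by linarith)]
    push_cast; ring

open Finset in
theorem sum_range_min_succ_sq {a n : ℕ} (h : a ≤ n) :
    ∑ b ∈ range n, min ((a : ℝ) + 1) ((b : ℝ) + 1) ^ 2
      = (n + 1 / 2) * ((a : ℝ) + 1) ^ 2 + ((a : ℝ) + 1) / 6 - 2 * ((a : ℝ) + 1) ^ 3 / 3 := by
  induction n, h using Nat.le_induction with
  | base =>
    have : ∀ b ∈ range a, min ((a : ℝ) + 1) ((b : ℝ) + 1) ^ 2 = ((b : ℝ) + 1) ^ 2 := fun b hb => by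
      have : (b : ℝ) ≤ a := by exact_mod_cast (mem_range.1 hb).le
      rw [min_eq_right (by linarith)]
    rw [sum_congr rfl this, sum_range_succ_cast_sq]
    ring
  | succ n h ih =>
    have : (a : ℝ) ≤ n := by exact_mod_cast h
    rw [sum_range_succ, ih, min_eq_left (by linarith)]
    push_cast; ring

/-- The expectation of `f` under the uniform distribution on permutations. -/
def permMean {n : ℕ} (f : Equiv.Perm (Fin n) → ℝ) : ℝ :=
  (∑ σ, f σ) / Fintype.card (Equiv.Perm (Fin n))

section PermMean

variable {n : ℕ}

theorem permMean_add (f g : Equiv.Perm (Fin n) → ℝ) :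
    permMean (fun σ => f σ + g σ) = permMean f + permMean g := by
  simp only [permMean, Finset.sum_add_distrib, add_div]

theorem permMean_sub (f g : Equiv.Perm (Fin n) → ℝ) :
    permMean (fun σ => f σ - g σ) = permMean f - permMean g := by
  simp only [permMean, Finset.sum_sub_distrib, sub_div]

theorem permMean_const_mul (c : ℝ) (f : Equiv.Perm (Fin n) → ℝ) :
    permMean (fun σ => c * f σ) = c * permMean f := by
  simp only [permMean, ← Finset.mul_sum, mul_div_assoc]

theorem permMean_mul_const (c : ℝ) (f : Equiv.Perm (Fin n) → ℝ) :
    permMean (fun σ => f σ * c) = permMean f * c := by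
  simp only [mul_comm _ c, permMean_const_mul]

theorem permMean_div_const (c : ℝ) (f : Equiv.Perm (Fin n) → ℝ) :
    permMean (fun σ => f σ / c) = permMean f / c := by
  simp only [div_eq_mul_inv, permMean_mul_const]

theorem permMean_const (c : ℝ) : permMean (fun _ : Equiv.Perm (Fin n) => c) = c := by
  have : (Fintype.card (Equiv.Perm (Fin n)) : ℝ) ≠ 0 := by
    exact_mod_cast Fintype.card_ne_zero
  simp only [permMean, Finset.sum_const, Finset.card_univ, nsmul_eq_mul]
  field_simp

theorem permMean_finset_sum {ι : Type*} (s : Finset ι) (f : ι → Equiv.Perm (Fin n) → ℝ) :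
    permMean (fun σ => ∑ i ∈ s, f i σ) = ∑ i ∈ s, permMean (f i) := by
  simp only [permMean]
  rw [Finset.sum_comm, Finset.sum_div]

theorem permMean_mul_right (τ : Equiv.Perm (Fin n)) (f : Equiv.Perm (Fin n) → ℝ) :
    permMean (fun σ => f (σ * τ)) = permMean f := by
  simp only [permMean]
  rw [← Equiv.sum_comp (Equiv.mulRight τ) f]
  rfl

/-- Averaging over the value at an index `j` outside `s`, of a quantity that otherwise depends
on the permutation only through its values on `s`. -/
theorem permMean_apply_notMem (s : Finset (Fin n)) {j : Fin n} (hj : j ∉ s)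
    (h : Equiv.Perm (Fin n) → Fin n → ℝ)
    (hs : ∀ σ τ : Equiv.Perm (Fin n), (∀ i ∈ s, σ i = τ i) → h σ = h τ) :
    ((n : ℝ) - s.card) * permMean (fun σ => h σ (σ j))
      = permMean (fun σ => ∑ d, h σ d) - ∑ i ∈ s, permMean (fun σ => h σ (σ i)) := by
  have hsum : permMean (fun σ => ∑ d, h σ d) = ∑ i, permMean (fun σ => h σ (σ i)) := by
    rw [← permMean_finset_sum]
    exact congrArg permMean (funext fun σ => (Equiv.sum_comp σ (h σ)).symm)
  have hswap : ∀ i ∈ sᶜ, permMean (fun σ => h σ (σ i)) = permMean (fun σ => h σ (σ j)) := by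
    intro i hi
    rw [← permMean_mul_right (Equiv.swap i j)]
    refine congrArg permMean (funext fun σ => ?_)
    rw [hs (σ * Equiv.swap i j) σ]
    · simp
    · intro k hk
      have hki : k ≠ i := fun e => Finset.mem_compl.1 hi (e ▸ hk)
      have hkj : k ≠ j := fun e => hj (e ▸ hk)
      simp [Equiv.swap_apply_of_ne_of_ne hki hkj]
  have hcard : ((sᶜ.card : ℕ) : ℝ) = n - s.card := by
    rw [Finset.card_compl, Nat.cast_sub (Finset.card_le_univ s), Fintype.card_fin]
  rw [hsum, ← Finset.sum_add_sum_compl s, Finset.sum_congr rfl hswap, Finset.sum_const,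
    nsmul_eq_mul, hcard]
  ring

theorem permMean_apply (j : Fin n) (g : Fin n → ℝ) :
    (n : ℝ) * permMean (fun σ => g (σ j)) = ∑ d, g d := by
  simpa [permMean_const] using
    permMean_apply_notMem ∅ (Finset.notMem_empty j) (fun _ => g) (fun _ _ _ => rfl)

theorem permMean_apply₂ {i j : Fin n} (hij : i ≠ j) (g : Fin n → Fin n → ℝ) :
    ((n : ℝ) - 1) * permMean (fun σ => g (σ i) (σ j))
      = permMean (fun σ => ∑ d, g (σ i) d) - permMean (fun σ => g (σ i) (σ i)) := by
  simpa using permMean_apply_notMem {i} (by simpa using hij.symm) (fun σ => g (σ i))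
    (fun σ τ h => by simp [h i])

theorem permMean_apply₃ {i j k : Fin n} (hij : i ≠ j) (hik : i ≠ k) (hjk : j ≠ k)
    (g : Fin n → Fin n → Fin n → ℝ) :
    ((n : ℝ) - 2) * permMean (fun σ => g (σ i) (σ j) (σ k))
      = permMean (fun σ => ∑ d, g (σ i) (σ j) d)
        - (permMean (fun σ => g (σ i) (σ j) (σ i)) + permMean (fun σ => g (σ i) (σ j) (σ j))) := by
  simpa [hij, Finset.sum_pair] using permMean_apply_notMem {i, j} (j := k)
    (by simp [hik.symm, hjk.symm]) (fun σ => g (σ i) (σ j)) (fun σ τ h => by simp [h i, h j])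

theorem permMean_apply₄ {i j k l : Fin n} (hij : i ≠ j) (hik : i ≠ k) (hjk : j ≠ k)
    (hil : i ≠ l) (hjl : j ≠ l) (hkl : k ≠ l) (g : Fin n → Fin n → Fin n → Fin n → ℝ) :
    ((n : ℝ) - 3) * permMean (fun σ => g (σ i) (σ j) (σ k) (σ l))
      = permMean (fun σ => ∑ d, g (σ i) (σ j) (σ k) d)
        - (permMean (fun σ => g (σ i) (σ j) (σ k) (σ i))
          + (permMean (fun σ => g (σ i) (σ j) (σ k) (σ j))
            + permMean (fun σ => g (σ i) (σ j) (σ k) (σ k)))) := by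
  have := permMean_apply_notMem {i, j, k} (j := l)
    (by simp [hil.symm, hjl.symm, hkl.symm]) (fun σ => g (σ i) (σ j) (σ k))
    (fun σ τ h => by simp [h i, h j, h k])
  rw [Finset.sum_insert (by simp [hij, hik]), Finset.sum_pair hjk,
    Finset.card_insert_of_notMem (by simp [hij, hik]), Finset.card_pair hjk] at this
  norm_num at this
  exact this

/-- The rank in `[n]` encoded by an element of `Fin n`. -/
def rankVal (a : Fin n) : ℝ := ((a : ℕ) : ℝ) + 1

theorem sum_rankVal : ∑ b : Fin n, rankVal b = (n : ℝ) * (n + 1) / 2 :=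
  (Fin.sum_univ_eq_sum_range (fun b => (b : ℝ) + 1) n).trans (sum_range_succ_cast n)

theorem sum_rankVal_sq :
    ∑ b : Fin n, rankVal b ^ 2 = (n : ℝ) * (n + 1) * (2 * n + 1) / 6 :=
  (Fin.sum_univ_eq_sum_range (fun b => ((b : ℝ) + 1) ^ 2) n).trans (sum_range_succ_cast_sq n)

theorem sum_rankVal_cube : ∑ b : Fin n, rankVal b ^ 3 = (n : ℝ) ^ 2 * (n + 1) ^ 2 / 4 :=
  (Fin.sum_univ_eq_sum_range (fun b => ((b : ℝ) + 1) ^ 3) n).trans (sum_range_succ_cast_cube n)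

theorem sum_rankVal_pow_four :
    ∑ b : Fin n, rankVal b ^ 4
      = (n : ℝ) * (n + 1) * (2 * n + 1) * (3 * n ^ 2 + 3 * n - 1) / 30 :=
  (Fin.sum_univ_eq_sum_range (fun b => ((b : ℝ) + 1) ^ 4) n).trans (sum_range_succ_cast_pow_four n)

theorem sum_min_rankVal (a : Fin n) :
    ∑ b : Fin n, min (rankVal a) (rankVal b) = ((2 * n + 1) * rankVal a - rankVal a ^ 2) / 2 :=
  (Fin.sum_univ_eq_sum_range (fun b => min (rankVal a) ((b : ℝ) + 1)) n).trans
    (sum_range_min_succ a.isLt.le)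

theorem sum_min_rankVal_sq (a : Fin n) :
    ∑ b : Fin n, min (rankVal a) (rankVal b) ^ 2
      = (n + 1 / 2) * rankVal a ^ 2 + rankVal a / 6 - 2 * rankVal a ^ 3 / 3 :=
  (Fin.sum_univ_eq_sum_range (fun b => min (rankVal a) ((b : ℝ) + 1) ^ 2) n).trans
    (sum_range_min_succ_sq a.isLt.le)

theorem permMean_rank (i : Fin n) :
    permMean (fun σ => rankVal (σ i)) = ((n : ℝ) + 1) / 2 := by
  have hn : (n : ℝ) ≠ 0 := by exact_mod_cast i.pos.ne'
  refine mul_left_cancel₀ hn ?_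
  rw [permMean_apply, sum_rankVal]; ring

theorem permMean_rank_sq (i : Fin n) :
    permMean (fun σ => rankVal (σ i) ^ 2) = ((n : ℝ) + 1) * (2 * n + 1) / 6 := by
  have hn : (n : ℝ) ≠ 0 := by exact_mod_cast i.pos.ne'
  refine mul_left_cancel₀ hn ?_
  rw [permMean_apply i (fun a => rankVal a ^ 2), sum_rankVal_sq]; ring

theorem permMean_rank_cube (i : Fin n) :
    permMean (fun σ => rankVal (σ i) ^ 3) = (n : ℝ) * (n + 1) ^ 2 / 4 := by
  have hn : (n : ℝ) ≠ 0 := by exact_mod_cast i.pos.ne'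
  refine mul_left_cancel₀ hn ?_
  rw [permMean_apply i (fun a => rankVal a ^ 3), sum_rankVal_cube]; ring

theorem permMean_rank_pow_four (i : Fin n) :
    permMean (fun σ => rankVal (σ i) ^ 4)
      = ((n : ℝ) + 1) * (2 * n + 1) * (3 * n ^ 2 + 3 * n - 1) / 30 := by
  have hn : (n : ℝ) ≠ 0 := by exact_mod_cast i.pos.ne'
  refine mul_left_cancel₀ hn ?_
  rw [permMean_apply i (fun a => rankVal a ^ 4), sum_rankVal_pow_four]; ring

theorem cast_sub_one_ne_zero_of_ne {i j : Fin n} (hij : i ≠ j) : (n : ℝ) - 1 ≠ 0 := by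
  have : n ≠ 1 := by rintro rfl; exact hij (Subsingleton.elim i j)
  exact sub_ne_zero.2 (by exact_mod_cast this)

theorem permMean_rank_mul_rank {i j : Fin n} (hij : i ≠ j) :
    permMean (fun σ => rankVal (σ i) * rankVal (σ j)) = ((n : ℝ) + 1) * (3 * n + 2) / 12 := by
  refine mul_left_cancel₀ (cast_sub_one_ne_zero_of_ne hij) ?_
  rw [permMean_apply₂ hij (fun a b => rankVal a * rankVal b)]
  simp only [← Finset.mul_sum, sum_rankVal, permMean_mul_const, ← pow_two, permMean_rank,
    permMean_rank_sq]
  ring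

theorem permMean_min {i j : Fin n} (hij : i ≠ j) :
    permMean (fun σ => min (rankVal (σ i)) (rankVal (σ j))) = ((n : ℝ) + 1) / 3 := by
  refine mul_left_cancel₀ (cast_sub_one_ne_zero_of_ne hij) ?_
  rw [permMean_apply₂ hij (fun a b => min (rankVal a) (rankVal b))]
  simp only [sum_min_rankVal, min_self, permMean_div_const, permMean_sub, permMean_const_mul,
    permMean_rank, permMean_rank_sq]
  ring

theorem permMean_rank_mul_min {i j : Fin n} (hij : i ≠ j) :
    permMean (fun σ => rankVal (σ i) * min (rankVal (σ i)) (rankVal (σ j)))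
      = ((n : ℝ) + 1) * (5 * n + 2) / 24 := by
  refine mul_left_cancel₀ (cast_sub_one_ne_zero_of_ne hij) ?_
  rw [permMean_apply₂ hij (fun a b => rankVal a * min (rankVal a) (rankVal b))]
  have (x : ℝ) : x * (((2 * n + 1) * x - x ^ 2) / 2) = ((2 * n + 1) * x ^ 2 - x ^ 3) / 2 := by ring
  simp only [← Finset.mul_sum, sum_min_rankVal, min_self, this, ← pow_two, permMean_div_const,
    permMean_sub, permMean_const_mul, permMean_rank_sq, permMean_rank_cube]
  ring

theorem permMean_rank_sq_mul_min {i j : Fin n} (hij : i ≠ j) :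
    permMean (fun σ => rankVal (σ i) ^ 2 * min (rankVal (σ i)) (rankVal (σ j)))
      = ((n : ℝ) + 1) * (18 * n ^ 2 + 15 * n - 2) / 120 := by
  refine mul_left_cancel₀ (cast_sub_one_ne_zero_of_ne hij) ?_
  rw [permMean_apply₂ hij (fun a b => rankVal a ^ 2 * min (rankVal a) (rankVal b))]
  have (x : ℝ) : x ^ 2 * (((2 * n + 1) * x - x ^ 2) / 2) = ((2 * n + 1) * x ^ 3 - x ^ 4) / 2 := by
    ring
  simp only [← Finset.mul_sum, sum_min_rankVal, min_self, this, ← pow_succ, Nat.reduceAdd,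
    permMean_div_const, permMean_sub, permMean_const_mul, permMean_rank_cube,
    permMean_rank_pow_four]
  ring

theorem permMean_min_sq {i j : Fin n} (hij : i ≠ j) :
    permMean (fun σ => min (rankVal (σ i)) (rankVal (σ j)) ^ 2) = (n : ℝ) * (n + 1) / 6 := by
  refine mul_left_cancel₀ (cast_sub_one_ne_zero_of_ne hij) ?_
  rw [permMean_apply₂ hij (fun a b => min (rankVal a) (rankVal b) ^ 2)]
  simp only [sum_min_rankVal_sq, min_self, permMean_div_const, permMean_sub, permMean_add,
    permMean_const_mul, permMean_rank, permMean_rank_sq, permMean_rank_cube]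
  ring

theorem cast_sub_two_ne_zero_of_ne {i j k : Fin n} (hij : i ≠ j) (hik : i ≠ k) (hjk : j ≠ k) :
    (n : ℝ) - 2 ≠ 0 := by
  have : n ≠ 2 := by rintro rfl; omega
  exact sub_ne_zero.2 (by exact_mod_cast this)

theorem permMean_min_mul_rank {i j k : Fin n} (hij : i ≠ j) (hik : i ≠ k) (hjk : j ≠ k) :
    permMean (fun σ => min (rankVal (σ i)) (rankVal (σ j)) * rankVal (σ k))
      = ((n : ℝ) + 1) * (2 * n + 1) / 12 := by
  refine mul_left_cancel₀ (cast_sub_two_ne_zero_of_ne hij hik hjk) ?_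
  rw [permMean_apply₃ hij hik hjk (fun a b c => min (rankVal a) (rankVal b) * rankVal c)]
  have hi : permMean (fun σ => min (rankVal (σ i)) (rankVal (σ j)) * rankVal (σ i))
      = ((n : ℝ) + 1) * (5 * n + 2) / 24 := by
    simpa only [mul_comm] using permMean_rank_mul_min hij
  have hj : permMean (fun σ => min (rankVal (σ i)) (rankVal (σ j)) * rankVal (σ j))
      = ((n : ℝ) + 1) * (5 * n + 2) / 24 := by
    simpa only [mul_comm, min_comm] using permMean_rank_mul_min hij.symm
  simp only [← Finset.mul_sum, sum_rankVal, permMean_mul_const, permMean_min hij, hi, hj]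
  ring

theorem permMean_min_mul_rank_sq {i j k : Fin n} (hij : i ≠ j) (hik : i ≠ k) (hjk : j ≠ k) :
    permMean (fun σ => min (rankVal (σ i)) (rankVal (σ j)) * rankVal (σ k) ^ 2)
      = ((n : ℝ) + 1) * (20 * n ^ 2 + 16 * n - 3) / 180 := by
  refine mul_left_cancel₀ (cast_sub_two_ne_zero_of_ne hij hik hjk) ?_
  rw [permMean_apply₃ hij hik hjk (fun a b c => min (rankVal a) (rankVal b) * rankVal c ^ 2)]
  have hi : permMean (fun σ => min (rankVal (σ i)) (rankVal (σ j)) * rankVal (σ i) ^ 2)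
      = ((n : ℝ) + 1) * (18 * n ^ 2 + 15 * n - 2) / 120 := by
    simpa only [mul_comm] using permMean_rank_sq_mul_min hij
  have hj : permMean (fun σ => min (rankVal (σ i)) (rankVal (σ j)) * rankVal (σ j) ^ 2)
      = ((n : ℝ) + 1) * (18 * n ^ 2 + 15 * n - 2) / 120 := by
    simpa only [mul_comm, min_comm] using permMean_rank_sq_mul_min hij.symm
  simp only [← Finset.mul_sum, sum_rankVal_sq, permMean_mul_const, permMean_min hij, hi, hj]
  ring

theorem permMean_min_mul_min_of_common {i j k : Fin n} (hij : i ≠ j) (hik : i ≠ k)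
    (hjk : j ≠ k) :
    permMean (fun σ => min (rankVal (σ i)) (rankVal (σ j)) * min (rankVal (σ i)) (rankVal (σ k)))
      = ((n : ℝ) + 1) * (8 * n + 1) / 60 := by
  refine mul_left_cancel₀ (cast_sub_two_ne_zero_of_ne hij hik hjk) ?_
  rw [permMean_apply₃ hij hik hjk
    (fun a b c => min (rankVal a) (rankVal b) * min (rankVal a) (rankVal c))]
  have (x m : ℝ) : m * (((2 * n + 1) * x - x ^ 2) / 2)
      = ((2 * n + 1) * (x * m) - x ^ 2 * m) / 2 := by ring
  have hi := permMean_rank_mul_min hij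
  simp only [mul_comm (rankVal _)] at hi
  simp only [← Finset.mul_sum, sum_min_rankVal, this, min_self, ← pow_two, permMean_div_const,
    permMean_sub, permMean_const_mul, permMean_rank_mul_min hij, permMean_rank_sq_mul_min hij,
    permMean_min_sq hij, hi]
  ring

theorem permMean_min_mul_min {i j k l : Fin n} (hij : i ≠ j) (hik : i ≠ k) (hjk : j ≠ k)
    (hil : i ≠ l) (hjl : j ≠ l) (hkl : k ≠ l) :
    permMean (fun σ => min (rankVal (σ i)) (rankVal (σ j)) * min (rankVal (σ k)) (rankVal (σ l)))
      = ((n : ℝ) + 1) * (5 * n + 1) / 45 := by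
  have hn : (n : ℝ) - 3 ≠ 0 := by
    have : n ≠ 3 := by rintro rfl; omega
    exact sub_ne_zero.2 (by exact_mod_cast this)
  refine mul_left_cancel₀ hn ?_
  rw [permMean_apply₄ hij hik hjk hil hjl hkl
    (fun a b c d => min (rankVal a) (rankVal b) * min (rankVal c) (rankVal d))]
  have (x m : ℝ) : m * (((2 * n + 1) * x - x ^ 2) / 2)
      = ((2 * n + 1) * (m * x) - m * x ^ 2) / 2 := by ring
  have hi : permMean (fun σ => min (rankVal (σ i)) (rankVal (σ j)) * min (rankVal (σ k)) (rankVal (σ i)))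
      = ((n : ℝ) + 1) * (8 * n + 1) / 60 := by
    simpa only [min_comm] using permMean_min_mul_min_of_common hij hik hjk
  have hj : permMean (fun σ => min (rankVal (σ i)) (rankVal (σ j)) * min (rankVal (σ k)) (rankVal (σ j)))
      = ((n : ℝ) + 1) * (8 * n + 1) / 60 := by
    simpa only [min_comm] using permMean_min_mul_min_of_common hij.symm hjk hik
  simp only [← Finset.mul_sum, sum_min_rankVal, this, min_self, permMean_div_const,
    permMean_sub, permMean_const_mul, permMean_min_mul_rank hij hik hjk,
    permMean_min_mul_rank_sq hij hik hjk, hi, hj]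
  ring

end PermMean

section Law

variable {Ω : Type*} [MeasurableSpace Ω] {P : Measure Ω} {n : ℕ} {σ : Ω → Equiv.Perm (Fin n)}

theorem integral_comp_eq_permMean (hσmeas : Measurable σ)
    (hσlaw : P.map σ = (PMF.uniformOfFintype (Equiv.Perm (Fin n))).toMeasure)
    (f : Equiv.Perm (Fin n) → ℝ) : ∫ ω, f (σ ω) ∂P = permMean f := by
  have : MeasurableSingletonClass (Equiv.Perm (Fin n)) := ⟨fun _ => trivial⟩
  rw [← integral_map hσmeas.aemeasurable (Measurable.of_discrete (f := f)).aestronglyMeasurable,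
    hσlaw, PMF.integral_eq_sum, permMean, Finset.sum_div]
  refine Finset.sum_congr rfl fun τ _ => ?_
  simp [div_eq_inv_mul]

theorem cov_comp_eq_permMean (hσmeas : Measurable σ)
    (hσlaw : P.map σ = (PMF.uniformOfFintype (Equiv.Perm (Fin n))).toMeasure)
    (f g : Equiv.Perm (Fin n) → ℝ) :
    cov P (fun ω => f (σ ω)) (fun ω => g (σ ω))
      = permMean (fun τ => f τ * g τ) - permMean f * permMean g := by
  unfold cov
  rw [integral_comp_eq_permMean hσmeas hσlaw f, integral_comp_eq_permMean hσmeas hσlaw g,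
    integral_comp_eq_permMean hσmeas hσlaw
      (fun τ => (f τ - permMean f) * (g τ - permMean g))]
  simp only [sub_mul, mul_sub, permMean_sub, permMean_const_mul, permMean_mul_const,
    permMean_const]
  ring

theorem variance_comp_eq_permMean (hσmeas : Measurable σ)
    (hσlaw : P.map σ = (PMF.uniformOfFintype (Equiv.Perm (Fin n))).toMeasure)
    (f : Equiv.Perm (Fin n) → ℝ) :
    variance (fun ω => f (σ ω)) P = permMean (fun τ => f τ ^ 2) - permMean f ^ 2 := by
  have : MeasurableSingletonClass (Equiv.Perm (Fin n)) := ⟨fun _ => trivial⟩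
  have hf : AEMeasurable (fun ω => f (σ ω)) P :=
    ((Measurable.of_discrete (f := f)).comp hσmeas).aemeasurable
  rw [variance_eq_integral hf]
  have := cov_comp_eq_permMean hσmeas hσlaw f f
  simpa only [cov, ← pow_two] using this

end Law

/-- Exact moment identities for a uniformly random permutation
`[R_1,…,R_n]` of `[n]`, `n ≥ 4`. -/
theorem uniform_permutation_moments
    {Ω : Type*} [MeasurableSpace Ω] (P : Measure Ω) [IsProbabilityMeasure P]
    (n : ℕ) (hn : 4 ≤ n)
    (σ : Ω → Equiv.Perm (Fin n)) (hσmeas : Measurable σ)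
    (hσlaw : P.map σ = (PMF.uniformOfFintype (Equiv.Perm (Fin n))).toMeasure) :
    letI R := rankRV σ
    letI i₁ : Fin n := ⟨0, by omega⟩
    letI i₂ : Fin n := ⟨1, by omega⟩
    letI i₃ : Fin n := ⟨2, by omega⟩
    letI i₄ : Fin n := ⟨3, by omega⟩
    (∫ ω, R i₁ ω ∂P = ((n : ℝ) + 1) / 2) ∧
    (∫ ω, min (R i₁ ω) (R i₂ ω) ∂P = ((n : ℝ) + 1) / 3) ∧
    (variance (R i₁) P = ((n : ℝ) + 1) * ((n : ℝ) - 1) / 12) ∧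
    (cov P (R i₁) (R i₂) = -(((n : ℝ) + 1) / 12)) ∧
    (cov P (R i₁) (fun ω => min (R i₂ ω) (R i₃ ω)) = -(((n : ℝ) + 1) / 12)) ∧
    (cov P (R i₁) (fun ω => min (R i₁ ω) (R i₂ ω))
        = ((n : ℝ) - 2) * ((n : ℝ) + 1) / 24) ∧
    (cov P (fun ω => min (R i₁ ω) (R i₂ ω)) (fun ω => min (R i₃ ω) (R i₄ ω))
        = -(4 * ((n : ℝ) + 1) / 45)) ∧
    (cov P (fun ω => min (R i₁ ω) (R i₂ ω)) (fun ω => min (R i₁ ω) (R i₃ ω))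
        = ((n : ℝ) + 1) * (4 * (n : ℝ) - 17) / 180) ∧
    (variance (fun ω => min (R i₁ ω) (R i₂ ω)) P
        = ((n : ℝ) - 2) * ((n : ℝ) + 1) / 18) := by
  let i₁ : Fin n := ⟨0, by omega⟩
  let i₂ : Fin n := ⟨1, by omega⟩
  let i₃ : Fin n := ⟨2, by omega⟩
  let i₄ : Fin n := ⟨3, by omega⟩
  have h12 : i₁ ≠ i₂ := by simp [i₁, i₂]
  have h13 : i₁ ≠ i₃ := by simp [i₁, i₃]
  have h14 : i₁ ≠ i₄ := by simp [i₁, i₄]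
  have h23 : i₂ ≠ i₃ := by simp [i₂, i₃]
  have h24 : i₂ ≠ i₄ := by simp [i₂, i₄]
  have h34 : i₃ ≠ i₄ := by simp [i₃, i₄]
  have hE := integral_comp_eq_permMean hσmeas hσlaw
  have hC := cov_comp_eq_permMean hσmeas hσlaw
  have hV := variance_comp_eq_permMean hσmeas hσlaw
  let r (i : Fin n) (τ : Equiv.Perm (Fin n)) : ℝ := rankVal (τ i)
  let m (i j : Fin n) (τ : Equiv.Perm (Fin n)) : ℝ := min (rankVal (τ i)) (rankVal (τ j))
  refine ⟨(hE (r i₁)).trans (permMean_rank i₁), (hE (m i₁ i₂)).trans (permMean_min h12),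
    (hV (r i₁)).trans ?_, (hC (r i₁) (r i₂)).trans ?_, (hC (r i₁) (m i₂ i₃)).trans ?_,
    (hC (r i₁) (m i₁ i₂)).trans ?_, (hC (m i₁ i₂) (m i₃ i₄)).trans ?_,
    (hC (m i₁ i₂) (m i₁ i₃)).trans ?_, (hV (m i₁ i₂)).trans ?_⟩ <;> simp only [r, m]
  · rw [permMean_rank_sq, permMean_rank]; ring
  · rw [permMean_rank_mul_rank h12, permMean_rank, permMean_rank]; ring
  · simp only [mul_comm (rankVal _)]
    rw [permMean_min_mul_rank h23 h12.symm h13.symm, permMean_rank, permMean_min h23]; ring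
  · rw [permMean_rank_mul_min h12, permMean_rank, permMean_min h12]; ring
  · rw [permMean_min_mul_min h12 h13 h23 h14 h24 h34, permMean_min h12, permMean_min h34]; ring
  · rw [permMean_min_mul_min_of_common h12 h13 h23, permMean_min h12, permMean_min h13]; ring
  · rw [permMean_min_sq h12, permMean_min h12]; ring
end
end
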